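/- arXiv:quant-ph/0502007 — 2 statements merged into one kernel-verified Lean document; each statement's English description precedes it below -/
import Mathlib

section
/- Bell's inequality: let μ be a probability measure on a measurable space Λ, and let A, B, C : Λ → ℝ be measurable functions each taking values in {-1, 1}. Define the hidden-variable correlations P(X,Y) = -∫ X(λ)·Y(λ) dμ(λ). Then 1 + P(B,C) ≥ |P(A,B) - P(A,C)|. -/
open MeasureTheory

/-- The product of two measurable `±1`-valued functions is integrable for a finite measure. -/
theorem integrable_mul_of_eq_neg_one_or_eq_one
    {Λ : Type*} [MeasurableSpace Λ] {μ : Measure Λ} [IsFiniteMeasure μ] {X Y : Λ → ℝ}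
    (hX : Measurable X) (hY : Measurable Y)
    (hX1 : ∀ l, X l = -1 ∨ X l = 1) (hY1 : ∀ l, Y l = -1 ∨ Y l = 1) :
    Integrable (fun l => X l * Y l) μ := by
  refine Integrable.of_bound (hX.mul hY).aestronglyMeasurable 1 (.of_forall fun l => ?_)
  rcases hX1 l with h | h <;> rcases hY1 l with h' | h' <;> simp [h, h']

/-- Bell's inequality: for a probability measure μ on the hidden-variable space Λ
and measurable outcome functions A, B, C : Λ → {-1,1}, the hidden-variable
correlations P(X,Y) = -∫ X·Y dμ satisfy 1 + P(B,C) ≥ |P(A,B) - P(A,C)|. -/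
theorem bell_inequality
    {Λ : Type*} [MeasurableSpace Λ] (μ : Measure Λ) [IsProbabilityMeasure μ]
    (A B C : Λ → ℝ)
    (hA : Measurable A) (hB : Measurable B) (hC : Measurable C)
    (hA1 : ∀ l, A l = -1 ∨ A l = 1)
    (hB1 : ∀ l, B l = -1 ∨ B l = 1)
    (hC1 : ∀ l, C l = -1 ∨ C l = 1) :
    1 + (-∫ l, B l * C l ∂μ) ≥
      |(-∫ l, A l * B l ∂μ) - (-∫ l, A l * C l ∂μ)| := by
  have hAB := integrable_mul_of_eq_neg_one_or_eq_one (μ := μ) hA hB hA1 hB1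
  have hAC := integrable_mul_of_eq_neg_one_or_eq_one (μ := μ) hA hC hA1 hC1
  have hBC := integrable_mul_of_eq_neg_one_or_eq_one (μ := μ) hB hC hB1 hC1
  have hpoint (l : Λ) : |A l * C l - A l * B l| = 1 - B l * C l := by
    rcases hA1 l with h | h <;> rcases hB1 l with h' | h' <;> rcases hC1 l with h'' | h'' <;>
      norm_num [h, h', h'']
  calc
    |(-∫ l, A l * B l ∂μ) - (-∫ l, A l * C l ∂μ)|
        = |∫ l, (A l * C l - A l * B l) ∂μ| := by
          rw [integral_sub hAC hAB]
          congr 1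
          ring
    _ ≤ ∫ l, |A l * C l - A l * B l| ∂μ := abs_integral_le_integral_abs
    _ = ∫ l, (1 - B l * C l) ∂μ := by simp only [hpoint]
    _ = 1 + (-∫ l, B l * C l ∂μ) := by
          rw [integral_sub (integrable_const 1) hBC]
          simp [sub_eq_add_neg]
end

section
/- Let ψ be the singlet state, let σx, σy, σz be the Pauli matrices, and for a vector v = (v₀, v₁, v₂) of real numbers let σ(v) = v₀•σx + v₁•σy + v₂•σz. Then for all real vectors a, b ∈ ℝ³, the expectation value of the Kronecker product operator σ(a) ⊗ σ(b) in the state ψ equals -(a₀b₀ + a₁b₁ + a₂b₂); that is, (star ψ) ⬝ᵥ ((σ(a) ⊗ σ(b)) *ᵥ ψ) = -(a·b) as a complex number. -/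
open Matrix Kronecker

/-- The Pauli matrix σx. -/
noncomputable def pauliX : Matrix (Fin 2) (Fin 2) ℂ := !![0, 1; 1, 0]

/-- The Pauli matrix σy. -/
noncomputable def pauliY : Matrix (Fin 2) (Fin 2) ℂ :=
  !![0, -Complex.I; Complex.I, 0]

/-- The Pauli matrix σz. -/
noncomputable def pauliZ : Matrix (Fin 2) (Fin 2) ℂ := !![1, 0; 0, -1]

/-- The spin observable along a direction v ∈ ℝ³. -/
noncomputable def pauliVec (v : Fin 3 → ℝ) : Matrix (Fin 2) (Fin 2) ℂ :=
  (v 0 : ℂ) • pauliX + (v 1 : ℂ) • pauliY + (v 2 : ℂ) • pauliZ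

/-- The singlet state of two spin-½ particles in ℂ² ⊗ ℂ². -/
noncomputable def singlet : Fin 2 × Fin 2 → ℂ := fun p =>
  if p = ((0 : Fin 2), (1 : Fin 2)) then (1 / Real.sqrt 2 : ℝ)
  else if p = ((1 : Fin 2), (0 : Fin 2)) then (-(1 / Real.sqrt 2) : ℝ)
  else 0

/-- The expectation value of σ(a) ⊗ σ(b) in the singlet state equals -(a·b):
the quantum-mechanical EPRB prediction 𝒫(a,b) = -a·b. -/
theorem singlet_correlation (a b : Fin 3 → ℝ) :
    (star singlet) ⬝ᵥ ((pauliVec a ⊗ₖ pauliVec b).mulVec singlet)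
      = -((a 0 * b 0 + a 1 * b 1 + a 2 * b 2 : ℝ) : ℂ) := by
  have h : ((Real.sqrt 2 : ℝ) : ℂ)⁻¹ ^ 2 = 1 / 2 := by
    rw [inv_pow, ← Complex.ofReal_pow, Real.sq_sqrt zero_le_two]
    norm_num
  simp [dotProduct, mulVec, Fintype.sum_prod_type, Fin.sum_univ_two, singlet, pauliVec,
    pauliX, pauliY, pauliZ]
  linear_combination (-2 * (a 0 * b 0 + a 1 * b 1 + a 2 * b 2) : ℂ) * h +
    2 * ((Real.sqrt 2 : ℝ) : ℂ)⁻¹ ^ 2 * a 1 * b 1 * Complex.I_sq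
end
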